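/- arXiv:2406.11692 — 2 statements merged into one kernel-verified Lean document; each statement's English description precedes it below -/
import Mathlib

section
/- Let n ≥ 2, m ≥ 1, c ∈ ℝ and λ ∈ [0,1). Then there exists a constant δ > 0 such that for all β ∈ Sym(V×V,W): c + H_β² − λ·ρ⊥(β) − ρ_c(β) ≥ δ·(ψ_0(β))^{2/n}. -/
open scoped RealInnerProductSpace BigOperators
open MeasureTheory Classical

namespace Paper

variable {V W : Type*} [NormedAddCommGroup V] [InnerProductSpace ℝ V]
  [NormedAddCommGroup W] [InnerProductSpace ℝ W]

/-- `β` is a symmetric bilinear map. -/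
def IsSymmBil (β : V →ₗ[ℝ] V →ₗ[ℝ] W) : Prop := ∀ x y, β x y = β y x

/-- The formal shape operator `A_ξ(β)`, determined by `⟪β x y, ξ⟫ = ⟪A_ξ(β) x, y⟫`. -/
noncomputable def shapeOp (β : V →ₗ[ℝ] V →ₗ[ℝ] W) (ξ : W) : V →ₗ[ℝ] V :=
  if h : ∃ A : V →ₗ[ℝ] V, ∀ x y : V, ⟪β x y, ξ⟫ = ⟪A x, y⟫ then h.choose else 0

variable {n m : ℕ}

/-- The mean curvature vector `𝓗_β = (1/n) Σ_i β(e_i, e_i)`. -/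
noncomputable def meanCurv (e : OrthonormalBasis (Fin n) ℝ V)
    (β : V →ₗ[ℝ] V →ₗ[ℝ] W) : W :=
  (n : ℝ)⁻¹ • ∑ i, β (e i) (e i)

/-- The formal Ricci tensor `Ric_c(β)`. -/
noncomputable def ric (c : ℝ) (e : OrthonormalBasis (Fin n) ℝ V)
    (β : V →ₗ[ℝ] V →ₗ[ℝ] W) (x y : V) : ℝ :=
  c * (n - 1) * ⟪x, y⟫ + n * ⟪meanCurv e β, β x y⟫
    - ∑ i, ⟪β x (e i), β y (e i)⟫

/-- The normalized scalar curvature `ρ_c(β) = (1/(n(n-1))) tr Ric_c(β)`. -/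
noncomputable def rho (c : ℝ) (e : OrthonormalBasis (Fin n) ℝ V)
    (β : V →ₗ[ℝ] V →ₗ[ℝ] W) : ℝ :=
  (n * (n - 1) : ℝ)⁻¹ * ∑ i, ric c e β (e i) (e i)

/-- The self-adjoint operator `T_c(β)` with `⟪T_c(β) x, y⟫ = (1/(n-1)) Ric_c(β)(x,y)`. -/
noncomputable def ricOp (c : ℝ) (e : OrthonormalBasis (Fin n) ℝ V)
    (β : V →ₗ[ℝ] V →ₗ[ℝ] W) : V →ₗ[ℝ] V :=
  if h : ∃ T : V →ₗ[ℝ] V, ∀ x y : V, ⟪T x, y⟫ = (n - 1 : ℝ)⁻¹ * ric c e β x y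
  then h.choose else 0

/-- The increasingly ordered eigenvalues of an endomorphism admitting an orthonormal
eigenbasis (junk value otherwise). -/
noncomputable def sortedEigs (n : ℕ) (T : V →ₗ[ℝ] V) : Fin n → ℝ :=
  if h : ∃ μ : Fin n → ℝ, Monotone μ ∧
      ∃ b : OrthonormalBasis (Fin n) ℝ V, ∀ i, T (b i) = μ i • b i
  then h.choose else fun _ => 0

/-- The `k`-th scalar curvature `ρ_{c,k}(β) = (1/k) Σ_{i=1}^k λ_{c,i}(β)`. -/
noncomputable def rhoK (c : ℝ) (k : ℕ) (e : OrthonormalBasis (Fin n) ℝ V)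
    (β : V →ₗ[ℝ] V →ₗ[ℝ] W) : ℝ :=
  (k : ℝ)⁻¹ * ∑ i ∈ Finset.univ.filter (fun i : Fin n => (i : ℕ) < k),
    sortedEigs n (ricOp c e β) i

/-- The normal scalar curvature `ρ⊥(β)`. -/
noncomputable def rhoPerp (e : OrthonormalBasis (Fin n) ℝ V)
    (ξ : OrthonormalBasis (Fin m) ℝ W) (β : V →ₗ[ℝ] V →ₗ[ℝ] W) : ℝ :=
  (n * (n - 1) : ℝ)⁻¹ * Real.sqrt (∑ a, ∑ b, ∑ i,
    ‖(shapeOp β (ξ a) ∘ₗ shapeOp β (ξ b) - shapeOp β (ξ b) ∘ₗ shapeOp β (ξ a)) (e i)‖ ^ 2)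

/-- The index of a self-adjoint endomorphism: the number of negative eigenvalues,
counted with multiplicity. -/
noncomputable def negIndex (n : ℕ) (T : V →ₗ[ℝ] V) : ℕ :=
  (Finset.univ.filter (fun i : Fin n => sortedEigs n T i < 0)).card

/-- The Hilbert–Schmidt norm `‖β‖² = Σ_{i,j} ‖β(e_i,e_j)‖²`. -/
noncomputable def normHS (e : OrthonormalBasis (Fin n) ℝ V)
    (β : V →ₗ[ℝ] V →ₗ[ℝ] W) : ℝ :=
  Real.sqrt (∑ i, ∑ j, ‖β (e i) (e j)‖ ^ 2)

/-- `ψ_p(β) = ∫_{Λ_p(β)} |det A_u(β)| dS_u` over the unit sphere of `W = ℝ^m`. -/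
noncomputable def psi (n m p : ℕ)
    (β : EuclideanSpace ℝ (Fin n) →ₗ[ℝ] EuclideanSpace ℝ (Fin n) →ₗ[ℝ]
      EuclideanSpace ℝ (Fin m)) : ℝ :=
  ∫ u in {u : Metric.sphere (0 : EuclideanSpace ℝ (Fin m)) 1 |
      p < negIndex n (shapeOp β (u : EuclideanSpace ℝ (Fin m))) ∧
      negIndex n (shapeOp β (u : EuclideanSpace ℝ (Fin m))) < n - p},
    |LinearMap.det (shapeOp β (u : EuclideanSpace ℝ (Fin m)))|
    ∂((volume : Measure (EuclideanSpace ℝ (Fin m))).toSphere)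

lemma sum_sq_sub_le_star {ι : Type*} (T : Finset ι) (x : ι → ℝ) (a : ℝ)
    (h : a ^ 2 + ∑ j ∈ T, x j ^ 2 ≤ 1) : ∑ j ∈ T, ((a - x j) ^ 2 - 1) ≤ 1 := by
  have hcs : (∑ j ∈ T, x j) ^ 2 ≤ T.card * ∑ j ∈ T, x j ^ 2 := sq_sum_le_card_mul_sum_sq
  have hexp : ∑ j ∈ T, ((a - x j) ^ 2 - 1)
      = T.card * a ^ 2 - 2 * a * ∑ j ∈ T, x j + ∑ j ∈ T, x j ^ 2 - T.card := by
    rw [Finset.mul_sum]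
    have : ∀ j ∈ T, (a - x j) ^ 2 - 1 = a ^ 2 - 2 * a * x j + x j ^ 2 - 1 := fun j _ => by ring
    rw [Finset.sum_congr rfl this]
    simp [Finset.sum_sub_distrib, Finset.sum_add_distrib]
  rw [hexp]
  have hk : (0 : ℝ) ≤ T.card := Nat.cast_nonneg _
  nlinarith [sq_nonneg (a + ∑ j ∈ T, x j), mul_le_mul_of_nonneg_left h hk]

/-- Pairs at distance larger than one form a star. -/
lemma sum_pairs_le_one {ι : Type*} [Fintype ι] (x : ι → ℝ) (hx : ∑ i, x i ^ 2 ≤ 1) :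
    ∑ p ∈ Finset.univ.filter (fun p : ι × ι => 1 < x p.1 - x p.2),
      ((x p.1 - x p.2) ^ 2 - 1) ≤ 1 := by
  have hsum : ∀ s : Finset ι, ∑ i ∈ s, x i ^ 2 ≤ 1 := fun s =>
    (Finset.sum_le_univ_sum_of_nonneg (fun i => sq_nonneg _)).trans hx
  have habs : ∀ i, x i ^ 2 ≤ 1 := fun i => by simpa using hsum {i}
  have hsign : ∀ i j, 1 < x i - x j → 0 < x i ∧ x j < 0 := by
    intro i j hij
    have h1 := abs_le.1 (sq_le_one_iff_abs_le_one _ |>.1 (habs i))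
    have h2 := abs_le.1 (sq_le_one_iff_abs_le_one _ |>.1 (habs j))
    constructor <;> linarith [h1.1, h1.2, h2.1, h2.2]
  have hinter : ∀ i j k l, 1 < x i - x j → 1 < x k - x l → i = k ∨ j = l := by
    intro i j k l hij hkl
    by_contra! hne
    obtain ⟨hik, hjl⟩ := hne
    have s1 := hsign _ _ hij
    have s2 := hsign _ _ hkl
    have hil : i ≠ l := by rintro rfl; linarith [s1.1, s2.2]
    have hjk : j ≠ k := by rintro rfl; linarith [s1.2, s2.1]
    have hij' : i ≠ j := by rintro rfl; linarith [s1.1, s1.2]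
    have hkl' : k ≠ l := by rintro rfl; linarith [s2.1, s2.2]
    have := hsum {i, j, k, l}
    rw [Finset.sum_insert (by simp [hij', hik, hil]), Finset.sum_insert (by simp [hjk, hjl]),
      Finset.sum_insert (by simp [hkl']), Finset.sum_singleton] at this
    nlinarith [sq_nonneg (x i + x j), sq_nonneg (x k + x l)]
  set S := Finset.univ.filter (fun p : ι × ι => 1 < x p.1 - x p.2) with hS
  rcases S.eq_empty_or_nonempty with h0 | ⟨⟨i, j⟩, hij⟩
  · simp [h0]
  have hij' : 1 < x i - x j := by simpa [hS] using hij
  by_cases hfirst : ∀ p ∈ S, p.1 = i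
  · have himg : S = (S.image Prod.snd).image (fun q => (i, q)) := by
      ext ⟨a, b⟩
      simp only [Finset.mem_image, Prod.mk.injEq, Prod.exists, exists_eq_right]
      constructor
      · intro h
        have := hfirst _ h
        exact ⟨b, ⟨a, h⟩, this.symm, rfl⟩
      · rintro ⟨q, ⟨c, hc⟩, rfl, rfl⟩
        have := hfirst _ hc
        simp only at this
        rwa [this] at hc
    rw [himg, Finset.sum_image (by intro a _ b _; simp)]
    refine sum_sq_sub_le_star _ x (x i) ?_
    have hni : i ∉ S.image Prod.snd := by
      intro h
      simp only [Finset.mem_image, Prod.exists, exists_eq_right] at h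
      obtain ⟨a, ha⟩ := h
      have := hsign a i (by simpa [hS] using ha)
      linarith [this.2, (hsign _ _ hij').1]
    rw [← Finset.sum_insert (f := fun i => x i ^ 2) hni]
    exact hsum _
  · have hsecond : ∀ p ∈ S, p.2 = j := by
      push Not at hfirst
      obtain ⟨⟨k, l⟩, hkl, hki⟩ := hfirst
      have hkl' : 1 < x k - x l := by simpa [hS] using hkl
      have hl : l = j := (hinter _ _ _ _ hkl' hij').resolve_left hki
      subst hl
      rintro ⟨a, b⟩ hab
      have hab' : 1 < x a - x b := by simpa [hS] using hab
      by_contra hb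
      have e1 := (hinter _ _ _ _ hab' hij').resolve_right hb
      have e2 := (hinter _ _ _ _ hab' hkl').resolve_right hb
      exact hki (e2.symm.trans e1)
    have himg : S = (S.image Prod.fst).image (fun q => (q, j)) := by
      ext ⟨a, b⟩
      simp only [Finset.mem_image, Prod.mk.injEq]
      constructor
      · intro h
        exact ⟨a, ⟨(a, b), h, rfl⟩, rfl, (hsecond _ h).symm⟩
      · rintro ⟨q, ⟨⟨c, d⟩, hc, rfl⟩, rfl, rfl⟩
        have := hsecond _ hc
        simp only at this
        rwa [this] at hc
    rw [himg, Finset.sum_image (by intro a _ b _; simp)]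
    have hnj : j ∉ S.image Prod.fst := by
      intro h
      simp only [Finset.mem_image, Prod.exists, exists_and_right, exists_eq_right] at h
      obtain ⟨a, ha⟩ := h
      have := hsign j a (by simpa [hS] using ha)
      linarith [this.1, (hsign _ _ hij').2]
    have := sum_sq_sub_le_star (S.image Prod.fst) x (x j) (by
      rw [← Finset.sum_insert (f := fun i => x i ^ 2) hnj]
      exact hsum _)
    simpa only [sub_sq_comm] using this

lemma sum_weighted_sq_sub_le {ι : Type*} [Fintype ι] (x : ι → ℝ) (hx : ∑ i, x i ^ 2 ≤ 1)
    (w : ι → ι → ℝ) (M : ℝ) (hM : 0 ≤ M) (hw : ∀ i j, 0 ≤ w i j) (hwM : ∀ i j, i ≠ j → w i j ≤ M) :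
    ∑ i, ∑ j, (x i - x j) ^ 2 * w i j ≤ ∑ i, ∑ j, w i j + 2 * M := by
  have key : ∑ p : ι × ι, ((x p.1 - x p.2) ^ 2 - 1) * w p.1 p.2 ≤ 2 * M := by
    let f : ι × ι → ℝ := fun p => if 1 < x p.1 - x p.2 then (x p.1 - x p.2) ^ 2 - 1 else 0
    have hf : ∑ p, f p ≤ 1 := by
      have := sum_pairs_le_one x hx
      rwa [Finset.sum_filter] at this
    have hswap : ∑ p : ι × ι, f p.swap = ∑ p, f p :=
      Equiv.sum_comp (Equiv.prodComm ι ι) f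
    calc ∑ p : ι × ι, ((x p.1 - x p.2) ^ 2 - 1) * w p.1 p.2
        ≤ ∑ p : ι × ι, M * (f p + f p.swap) := by
          refine Finset.sum_le_sum fun p _ => ?_
          obtain ⟨i, j⟩ := p
          simp only [f, Prod.swap]
          have h0 := hw i j
          split_ifs with h1 h2 h2
          · linarith
          · have hij : i ≠ j := by rintro rfl; linarith
            rw [add_zero, mul_comm M]
            exact mul_le_mul_of_nonneg_left (hwM i j hij) (by nlinarith)
          · have hij : i ≠ j := by rintro rfl; linarith
            rw [zero_add, mul_comm M, sub_sq_comm (x j)]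
            exact mul_le_mul_of_nonneg_left (hwM i j hij) (by nlinarith)
          · have : (x i - x j) ^ 2 ≤ 1 := by
              rw [sq_le_one_iff_abs_le_one, abs_le]
              constructor <;> linarith
            nlinarith
      _ = M * (∑ p, f p + ∑ p : ι × ι, f p.swap) := by
          rw [← Finset.mul_sum, Finset.sum_add_distrib]
      _ ≤ 2 * M := by rw [hswap]; nlinarith
  simp only [sub_mul, one_mul, Finset.sum_sub_distrib] at key
  rw [Fintype.sum_prod_type, Fintype.sum_prod_type] at key
  linarith

/-- A quadratic form with vanishing diagonal is bounded by `(∑ t)²` on the positive orthant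
when its gradient is controlled in the direction of the largest coordinate. -/
lemma quadratic_le_sq_sum {κ : Type*} [Fintype κ] (c : κ → κ → ℝ)
    (hsymm : ∀ r s, c r s = c s r) (hdiag : ∀ r, c r r = 0)
    (hc : ∀ t : κ → ℝ, (∀ s, 0 ≤ t s) → ∀ r, (∀ s, t s ≤ t r) → ∑ s, c r s * t s ≤ ∑ s, t s)
    (t : κ → ℝ) (ht : ∀ s, 0 ≤ t s) :
    ∑ r, ∑ s, c r s * t r * t s ≤ (∑ s, t s) ^ 2 := by
  cases isEmpty_or_nonempty κ
  · simp
  let Q : (κ → ℝ) → ℝ := fun t => ∑ r, ∑ s, c r s * t r * t s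
  have hQc : Continuous Q := by fun_prop
  obtain ⟨p, hp, hmax⟩ := (isCompact_stdSimplex ℝ κ).exists_isMaxOn
    ⟨_, single_mem_stdSimplex ℝ (Classical.arbitrary κ)⟩ hQc.continuousOn
  have hhom : ∀ (a : ℝ) (t : κ → ℝ), Q (fun s => a * t s) = a ^ 2 * Q t := by
    intro a t
    simp only [Q, Finset.mul_sum]
    exact Finset.sum_congr rfl fun r _ => Finset.sum_congr rfl fun s _ => by ring
  have hbound : ∀ t : κ → ℝ, (∀ s, 0 ≤ t s) → Q t ≤ Q p * (∑ s, t s) ^ 2 := by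
    intro t ht
    rcases (Finset.sum_nonneg fun s (_ : s ∈ Finset.univ) => ht s).eq_or_lt with h0 | hpos
    · have : ∀ s, t s = 0 := fun s =>
        (Finset.sum_eq_zero_iff_of_nonneg fun s _ => ht s).1 h0.symm s (Finset.mem_univ s)
      simp [Q, this]
    · have hmem : (fun s => (∑ s, t s)⁻¹ * t s) ∈ stdSimplex ℝ κ :=
        ⟨fun s => mul_nonneg (inv_nonneg.2 hpos.le) (ht s), by
          rw [← Finset.mul_sum, inv_mul_cancel₀ hpos.ne']⟩
      have h := hmax hmem
      simp only [Set.mem_ofPred_eq, hhom] at h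
      rw [inv_pow, inv_mul_le_iff₀ (by positivity)] at h
      linarith
  have hM : Q p ≤ 1 := by
    by_contra! hM
    obtain ⟨r, -, hr⟩ := Finset.exists_max_image Finset.univ p Finset.univ_nonempty
    have hr' : ∀ s, p s ≤ p r := fun s => hr s (Finset.mem_univ s)
    have hprpos : 0 < p r := by
      by_contra! hle
      have : ∑ s, p s ≤ 0 := Finset.sum_nonpos fun s _ => (hr' s).trans hle
      linarith [hp.2]
    have hg := hc p hp.1 r hr'
    rw [hp.2] at hg
    let ε := min (p r) ((Q p - 1) / Q p)
    have hε : 0 < ε := lt_min hprpos (div_pos (by linarith) (by linarith))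
    have hε2 : ε * Q p ≤ Q p - 1 := by
      have : ε ≤ (Q p - 1) / Q p := min_le_right _ _
      rwa [le_div_iff₀ (by linarith)] at this
    have hq := hbound (fun s => p s - ε * (if s = r then 1 else 0)) (fun s => by
      by_cases h : s = r
      · subst h; simp; exact min_le_left _ _
      · simpa [h] using hp.1 s)
    have hsum : ∑ s, (p s - ε * (if s = r then 1 else 0)) = 1 - ε := by
      simp [Finset.sum_sub_distrib, hp.2]
    have hexp : Q (fun s => p s - ε * (if s = r then 1 else 0))
        = Q p - 2 * ε * ∑ s, c r s * p s := by
      have : ∀ a b, c a b * (p a - ε * (if a = r then 1 else 0))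
            * (p b - ε * (if b = r then 1 else 0))
          = c a b * p a * p b - (if b = r then ε * (c a b * p a) else 0)
            - (if a = r then ε * (c a b * p b) else 0)
            + (if a = r then (if b = r then ε ^ 2 * c a b else 0) else 0) := by
        intro a b
        split_ifs <;> ring
      have hcol : ∑ a, ε * (c a r * p a) = ε * ∑ s, c r s * p s := by
        rw [Finset.mul_sum]
        exact Finset.sum_congr rfl fun a _ => by rw [hsymm a r]
      have hrow : ∑ a, ∑ b, (if a = r then ε * (c a b * p b) else 0)
          = ε * ∑ s, c r s * p s := by
        rw [Finset.sum_comm, Finset.mul_sum]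
        simp
      have hdd : ∑ a, ∑ b, (if a = r then (if b = r then ε ^ 2 * c a b else 0) else 0) = 0 := by
        rw [Finset.sum_comm]
        simp [hdiag]
      simp only [Q, this, Finset.sum_add_distrib, Finset.sum_sub_distrib, hrow, hdd]
      simp only [Finset.sum_ite_eq', Finset.mem_univ, if_true, hcol]
      ring
    rw [hexp, hsum] at hq
    nlinarith
  calc Q t ≤ Q p * (∑ s, t s) ^ 2 := hbound t ht
    _ ≤ (∑ s, t s) ^ 2 := by nlinarith [sq_nonneg (∑ s, t s)]

/-- The Frobenius inner product of real matrices. -/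
def frobInner {ι : Type*} [Fintype ι] (A B : Matrix ι ι ℝ) : ℝ := (A.transpose * B).trace

section Frobenius

variable {ι : Type*} [Fintype ι] {κ : Type*}

lemma frobInner_eq_sum (A B : Matrix ι ι ℝ) : frobInner A B = ∑ i, ∑ j, A i j * B i j := by
  simp only [frobInner, Matrix.trace, Matrix.diag, Matrix.mul_apply, Matrix.transpose_apply]
  exact Finset.sum_comm

lemma frobInner_self (A : Matrix ι ι ℝ) : frobInner A A = ∑ i, ∑ j, A i j ^ 2 := by
  simp only [frobInner_eq_sum, sq]

lemma frobInner_self_nonneg (A : Matrix ι ι ℝ) : 0 ≤ frobInner A A := by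
  rw [frobInner_self]; positivity

lemma frobInner_sum_left (s : Finset κ) (f : κ → Matrix ι ι ℝ) (B : Matrix ι ι ℝ) :
    frobInner (∑ k ∈ s, f k) B = ∑ k ∈ s, frobInner (f k) B := by
  simp [frobInner, Matrix.transpose_sum, Finset.sum_mul, Matrix.trace_sum]

lemma frobInner_comm (A B : Matrix ι ι ℝ) : frobInner A B = frobInner B A := by
  simp only [frobInner_eq_sum, mul_comm]

lemma frobInner_sum_right (s : Finset κ) (f : κ → Matrix ι ι ℝ) (B : Matrix ι ι ℝ) :
    frobInner B (∑ k ∈ s, f k) = ∑ k ∈ s, frobInner B (f k) := by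
  rw [frobInner_comm, frobInner_sum_left]
  simp only [frobInner_comm]

lemma frobInner_smul_left (a : ℝ) (A B : Matrix ι ι ℝ) :
    frobInner (a • A) B = a * frobInner A B := by
  simp [frobInner]

lemma frobInner_smul_right (a : ℝ) (A B : Matrix ι ι ℝ) :
    frobInner A (a • B) = a * frobInner A B := by
  simp [frobInner]

lemma frobInner_conj (U A B : Matrix ι ι ℝ) (hU : U * U.transpose = 1) :
    frobInner (U.transpose * A * U) (U.transpose * B * U) = frobInner A B := by
  simp only [frobInner, Matrix.transpose_mul, Matrix.transpose_transpose]
  have : U.transpose * (A.transpose * U) * (U.transpose * B * U)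
      = U.transpose * (A.transpose * (U * U.transpose) * B * U) := by
    simp only [Matrix.mul_assoc]
  rw [this, hU, Matrix.mul_one, Matrix.trace_mul_comm, Matrix.mul_assoc, hU, Matrix.mul_one]

lemma exists_orthogonal_diagonal (A : Matrix ι ι ℝ) (hA : A.transpose = A) :
    ∃ (U : Matrix ι ι ℝ) (d : ι → ℝ), U * U.transpose = 1 ∧
      U.transpose * A * U = Matrix.diagonal d := by
  have hA' : A.IsHermitian := by
    rw [Matrix.IsHermitian, Matrix.conjTranspose_eq_transpose_of_trivial, hA]
  let u := hA'.eigenvectorUnitary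
  have hstar : star (u : Matrix ι ι ℝ) = (u : Matrix ι ι ℝ).transpose := by
    rw [Matrix.star_eq_conjTranspose, Matrix.conjTranspose_eq_transpose_of_trivial]
  have h1 : (u : Matrix ι ι ℝ) * (u : Matrix ι ι ℝ).transpose = 1 := by
    rw [← hstar]; exact Unitary.coe_mul_star_self u
  have h2 : (u : Matrix ι ι ℝ).transpose * u = 1 := by
    rw [← hstar]; exact Unitary.coe_star_mul_self u
  refine ⟨u, hA'.eigenvalues, h1, ?_⟩
  have hs := hA'.spectral_theorem
  rw [Unitary.conjStarAlgAut_apply] at hs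
  change A = (u : Matrix ι ι ℝ) * _ * star (u : Matrix ι ι ℝ) at hs
  rw [hstar] at hs
  conv_lhs => rw [hs]
  calc _ = ((u : Matrix ι ι ℝ).transpose * u) * Matrix.diagonal hA'.eigenvalues
        * ((u : Matrix ι ι ℝ).transpose * u) := by
        simp only [Matrix.mul_assoc]; rfl
    _ = _ := by rw [h2, Matrix.mul_one, Matrix.one_mul]

variable [Fintype κ]

/-- Bessel's inequality for off-diagonal entries of an orthogonal family of symmetric matrices. -/
lemma two_mul_sum_sq_entry_le (E : κ → Matrix ι ι ℝ) (hE : ∀ s, (E s).transpose = E s)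
    (hnorm : ∀ s, frobInner (E s) (E s) ≤ 1) (horth : ∀ r s, r ≠ s → frobInner (E r) (E s) = 0)
    (i j : ι) (hij : i ≠ j) : 2 * ∑ s, E s i j ^ 2 ≤ 1 := by
  let F : Matrix ι ι ℝ := Matrix.single i j 1 + Matrix.single j i 1
  have hEF : ∀ s, frobInner (E s) F = 2 * E s i j := by
    intro s
    have : E s j i = E s i j := by
      conv_lhs => rw [← hE s]
      rfl
    simp [frobInner, F, Matrix.mul_add, Matrix.trace_mul_single, this, two_mul]
  have hFF : frobInner F F = 2 := by
    have : F.transpose = F := by simp [F, add_comm]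
    simp only [frobInner, this]
    simp only [F, Matrix.mul_add, Matrix.trace_add, Matrix.trace_mul_single]
    simp [hij, hij.symm]
    norm_num
  let G := ∑ s, (2 * E s i j) • E s
  have hGF : frobInner G F = 4 * ∑ s, E s i j ^ 2 := by
    rw [frobInner_sum_left, Finset.mul_sum]
    exact Finset.sum_congr rfl fun s _ => by rw [frobInner_smul_left, hEF]; ring
  have hGG : frobInner G G ≤ 4 * ∑ s, E s i j ^ 2 := by
    rw [frobInner_sum_left, Finset.mul_sum]
    refine Finset.sum_le_sum fun s _ => ?_
    rw [frobInner_smul_left, frobInner_sum_right, Finset.sum_eq_single s]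
    · rw [frobInner_smul_right]
      nlinarith [hnorm s, sq_nonneg (E s i j)]
    · intro r _ hr
      rw [frobInner_smul_right, horth s r hr.symm, mul_zero]
    · simp
  have hpos := frobInner_self_nonneg (F - G)
  have hexp : frobInner (F - G) (F - G) = frobInner F F - 2 * frobInner G F + frobInner G G := by
    simp only [frobInner_eq_sum, Finset.mul_sum, ← Finset.sum_sub_distrib,
      ← Finset.sum_add_distrib, Matrix.sub_apply]
    exact Finset.sum_congr rfl fun _ _ => Finset.sum_congr rfl fun _ _ => by ring
  linarith

lemma sum_weighted_commutator_le (A : Matrix ι ι ℝ) (hA : A.transpose = A)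
    (hA1 : frobInner A A ≤ 1) (E : κ → Matrix ι ι ℝ) (hE : ∀ s, (E s).transpose = E s)
    (hnorm : ∀ s, frobInner (E s) (E s) ≤ 1) (horth : ∀ r s, r ≠ s → frobInner (E r) (E s) = 0)
    (t : κ → ℝ) (ht : ∀ s, 0 ≤ t s) (T : ℝ) (hT0 : 0 ≤ T) (hT : ∀ s, t s ≤ T) :
    ∑ s, frobInner (A * E s - E s * A) (A * E s - E s * A) * t s ≤ ∑ s, t s + T := by
  obtain ⟨U, d, hU, hd⟩ := exists_orthogonal_diagonal A hA
  let D : κ → Matrix ι ι ℝ := fun s => U.transpose * E s * U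
  have hDt : ∀ s, (D s).transpose = D s := by
    intro s
    simp only [D, Matrix.transpose_mul, Matrix.transpose_transpose, hE, Matrix.mul_assoc]
  have hDD : ∀ r s, frobInner (D r) (D s) = frobInner (E r) (E s) := fun r s =>
    frobInner_conj U _ _ hU
  have hd1 : ∑ i, d i ^ 2 ≤ 1 := by
    rw [← frobInner_conj U A A hU, hd] at hA1
    simpa [frobInner, Matrix.diagonal_mul_diagonal, Matrix.trace_diagonal, sq] using hA1
  have hcomm : ∀ s, frobInner (A * E s - E s * A) (A * E s - E s * A)
      = ∑ i, ∑ j, (d i - d j) ^ 2 * D s i j ^ 2 := by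
    intro s
    rw [← frobInner_conj U _ _ hU]
    have : U.transpose * (A * E s - E s * A) * U
        = Matrix.diagonal d * D s - D s * Matrix.diagonal d := by
      rw [← hd]
      simp only [D, Matrix.mul_sub, Matrix.sub_mul]
      have e : ∀ X Y : Matrix ι ι ℝ, U.transpose * X * U * (U.transpose * Y * U)
          = U.transpose * (X * Y) * U := by
        intro X Y
        calc _ = U.transpose * X * (U * U.transpose) * Y * U := by simp only [Matrix.mul_assoc]
          _ = _ := by rw [hU]; simp only [Matrix.mul_assoc, Matrix.one_mul]
      rw [e, e]
    rw [this, frobInner_self]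
    refine Finset.sum_congr rfl fun i _ => Finset.sum_congr rfl fun j _ => ?_
    rw [Matrix.sub_apply, Matrix.diagonal_mul, Matrix.mul_diagonal]
    ring
  have hstar := sum_weighted_sq_sub_le d hd1 (fun i j => ∑ s, D s i j ^ 2 * t s) (T / 2)
    (by linarith) (fun i j => Finset.sum_nonneg fun s _ => mul_nonneg (sq_nonneg _) (ht s))
    (fun i j hij => by
      have h := two_mul_sum_sq_entry_le D hDt (fun s => by rw [hDD]; exact hnorm s)
        (fun r s hrs => by rw [hDD]; exact horth r s hrs) i j hij
      calc ∑ s, D s i j ^ 2 * t s ≤ ∑ s, D s i j ^ 2 * T :=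
            Finset.sum_le_sum fun s _ => mul_le_mul_of_nonneg_left (hT s) (sq_nonneg _)
        _ = (∑ s, D s i j ^ 2) * T := by rw [Finset.sum_mul]
        _ ≤ T / 2 := by nlinarith)
  have hl : ∑ s, frobInner (A * E s - E s * A) (A * E s - E s * A) * t s
      = ∑ i, ∑ j, (d i - d j) ^ 2 * ∑ s, D s i j ^ 2 * t s := by
    simp only [hcomm, Finset.sum_mul, Finset.mul_sum]
    rw [Finset.sum_comm]
    refine Finset.sum_congr rfl fun i _ => ?_
    rw [Finset.sum_comm]
    exact Finset.sum_congr rfl fun j _ => Finset.sum_congr rfl fun s _ => by ring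
  have hr : ∑ i, ∑ j, ∑ s, D s i j ^ 2 * t s ≤ ∑ s, t s := by
    calc ∑ i, ∑ j, ∑ s, D s i j ^ 2 * t s = ∑ s, frobInner (D s) (D s) * t s := by
          simp only [frobInner_self, Finset.sum_mul]
          symm
          rw [Finset.sum_comm]
          exact Finset.sum_congr rfl fun i _ => Finset.sum_comm
      _ ≤ ∑ s, t s := Finset.sum_le_sum fun s _ => by
          rw [hDD]; nlinarith [hnorm s, ht s]
  rw [hl]
  linarith

lemma sum_sq_orthogonal (U : Matrix κ κ ℝ) (hU : U * U.transpose = 1) (y : κ → ℝ) :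
    ∑ k, (∑ r, U r k * y r) ^ 2 = ∑ r, y r ^ 2 := by
  have h : ∀ r s, ∑ k, U r k * U s k = if r = s then 1 else 0 := by
    intro r s
    have := congrFun (congrFun hU r) s
    simpa [Matrix.mul_apply, Matrix.one_apply] using this
  calc ∑ k, (∑ r, U r k * y r) ^ 2 = ∑ k, ∑ r, ∑ s, (U r k * U s k) * (y r * y s) := by
        refine Finset.sum_congr rfl fun k _ => ?_
        rw [sq, Finset.sum_mul_sum]
        exact Finset.sum_congr rfl fun _ _ => Finset.sum_congr rfl fun _ _ => by ring
    _ = ∑ r, ∑ s, (∑ k, U r k * U s k) * (y r * y s) := by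
        rw [Finset.sum_comm]
        refine Finset.sum_congr rfl fun r _ => ?_
        rw [Finset.sum_comm]
        simp only [Finset.sum_mul]
    _ = ∑ r, y r ^ 2 := by simp [h, sq]

lemma sum_frobInner_orthogonal (U : Matrix κ κ ℝ) (hU : U * U.transpose = 1)
    (L : Matrix ι ι ℝ →ₗ[ℝ] Matrix ι ι ℝ) (B : κ → Matrix ι ι ℝ) :
    ∑ k, frobInner (L (∑ r, U r k • B r)) (L (∑ r, U r k • B r))
      = ∑ r, frobInner (L (B r)) (L (B r)) := by
  simp only [frobInner_self, map_sum, map_smul, Matrix.sum_apply, Matrix.smul_apply, smul_eq_mul]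
  rw [Finset.sum_comm, Finset.sum_comm (s := (Finset.univ : Finset κ))]
  refine Finset.sum_congr rfl fun i _ => ?_
  rw [Finset.sum_comm, Finset.sum_comm (s := (Finset.univ : Finset κ))]
  exact Finset.sum_congr rfl fun j _ => sum_sq_orthogonal U hU _

/-- The DDVV inequality for pairwise orthogonal symmetric matrices. -/
lemma ddvv_of_orthogonal (A : κ → Matrix ι ι ℝ) (hA : ∀ r, (A r).transpose = A r)
    (horth : ∀ r s, r ≠ s → frobInner (A r) (A s) = 0) :
    ∑ r, ∑ s, frobInner (A r * A s - A s * A r) (A r * A s - A s * A r)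
      ≤ (∑ r, frobInner (A r) (A r)) ^ 2 := by
  let E : κ → Matrix ι ι ℝ := fun r => (Real.sqrt (frobInner (A r) (A r)))⁻¹ • A r
  have hAE : ∀ r, A r = Real.sqrt (frobInner (A r) (A r)) • E r := by
    intro r
    rcases (frobInner_self_nonneg (A r)).eq_or_lt with h | h
    · have hz : A r = 0 := by
        rw [frobInner_self] at h
        ext i j
        have h1 := (Finset.sum_eq_zero_iff_of_nonneg
          (fun i _ => Finset.sum_nonneg fun j _ => sq_nonneg _)).1 h.symm i (Finset.mem_univ i)
        have h2 := (Finset.sum_eq_zero_iff_of_nonneg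
          (fun j _ => sq_nonneg _)).1 h1 j (Finset.mem_univ j)
        simpa using h2
      simp [E, hz]
    · simp only [E, smul_smul]
      rw [mul_inv_cancel₀ (Real.sqrt_pos.2 h).ne', one_smul]
  have hEt : ∀ r, (E r).transpose = E r := fun r => by simp [E, hA]
  have hEn : ∀ r, frobInner (E r) (E r) ≤ 1 := by
    intro r
    simp only [E, frobInner_smul_left, frobInner_smul_right]
    rw [← mul_assoc, ← mul_inv, Real.mul_self_sqrt (frobInner_self_nonneg _)]
    exact inv_mul_le_one
  have hEo : ∀ r s, r ≠ s → frobInner (E r) (E s) = 0 := by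
    intro r s hrs
    simp [E, frobInner_smul_left, frobInner_smul_right, horth r s hrs]
  let c : κ → κ → ℝ := fun r s => frobInner (E r * E s - E s * E r) (E r * E s - E s * E r)
  have hq := quadratic_le_sq_sum c
    (fun r s => by
      simp only [c]
      rw [frobInner_self, frobInner_self]
      exact Finset.sum_congr rfl fun i _ => Finset.sum_congr rfl fun j _ => sub_sq_comm _ _)
    (fun r => by simp [c, frobInner])
    (fun t ht r hr => by
      have h := sum_weighted_commutator_le (E r) (hEt r) (hEn r) E hEt hEn hEo
        (fun s => if s = r then 0 else t s) (fun s => by split_ifs <;> simp [ht])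
        (t r) (ht r) (fun s => by split_ifs <;> simp [ht, hr])
      have h1 : ∑ s, (if s = r then 0 else t s) + t r = ∑ s, t s := by
        rw [← Finset.add_sum_erase _ t (Finset.mem_univ r),
          ← Finset.add_sum_erase _ (fun s => if s = r then 0 else t s) (Finset.mem_univ r)]
        rw [if_pos rfl, zero_add, add_comm]
        congr 1
        exact Finset.sum_congr rfl fun s hs => if_neg (Finset.ne_of_mem_erase hs)
      rw [h1] at h
      refine le_of_eq_of_le (Finset.sum_congr rfl fun s _ => ?_) h
      by_cases hs : s = r
      · subst hs; simp [c, frobInner]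
      · simp [hs, c])
    (fun r => frobInner (A r) (A r)) (fun r => frobInner_self_nonneg _)
  refine le_of_eq_of_le (Finset.sum_congr rfl fun r _ => Finset.sum_congr rfl fun s _ => ?_) hq
  have : A r * A s - A s * A r
      = (Real.sqrt (frobInner (A r) (A r)) * Real.sqrt (frobInner (A s) (A s))) •
        (E r * E s - E s * E r) := by
    conv_lhs => rw [hAE r, hAE s]
    simp only [Matrix.smul_mul, Matrix.mul_smul, smul_smul, smul_sub]
    rw [mul_comm (Real.sqrt (frobInner (A s) (A s)))]
  rw [this, frobInner_smul_left, frobInner_smul_right]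
  have e1 := Real.mul_self_sqrt (frobInner_self_nonneg (A r))
  have e2 := Real.mul_self_sqrt (frobInner_self_nonneg (A s))
  calc _ = c r s * (Real.sqrt (frobInner (A r) (A r)) * Real.sqrt (frobInner (A r) (A r)))
        * (Real.sqrt (frobInner (A s) (A s)) * Real.sqrt (frobInner (A s) (A s))) := by
        simp only [c]; ring
    _ = _ := by rw [e1, e2]

/-- The DDVV inequality of Ge–Tang and Lu. -/
theorem ddvv (B : κ → Matrix ι ι ℝ) (hB : ∀ r, (B r).transpose = B r) :
    ∑ r, ∑ s, frobInner (B r * B s - B s * B r) (B r * B s - B s * B r)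
      ≤ (∑ r, frobInner (B r) (B r)) ^ 2 := by
  let G : Matrix κ κ ℝ := Matrix.of fun r s => frobInner (B r) (B s)
  obtain ⟨U, d, hU, hd⟩ := exists_orthogonal_diagonal G (by
    ext r s; exact frobInner_comm _ _)
  let A : κ → Matrix ι ι ℝ := fun k => ∑ r, U r k • B r
  have horth : ∀ k l, k ≠ l → frobInner (A k) (A l) = 0 := by
    intro k l hkl
    have h := congrFun (congrFun hd k) l
    rw [Matrix.diagonal_apply_ne _ hkl] at h
    rw [← h]
    simp only [A, frobInner_sum_left, frobInner_sum_right, frobInner_smul_left,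
      frobInner_smul_right, Matrix.mul_apply, Matrix.transpose_apply, Matrix.of_apply, G,
      Finset.sum_mul, Finset.mul_sum]
    exact Finset.sum_congr rfl fun _ _ => Finset.sum_congr rfl fun _ _ => by ring
  have hmain := ddvv_of_orthogonal A (fun k => by
    simp only [A, Matrix.transpose_sum, Matrix.transpose_smul, hB]) horth
  have hnorm : ∑ r, frobInner (A r) (A r) = ∑ r, frobInner (B r) (B r) := by
    simpa using sum_frobInner_orthogonal U hU LinearMap.id B
  have hcomm : ∑ r, ∑ s, frobInner (A r * A s - A s * A r) (A r * A s - A s * A r)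
      = ∑ r, ∑ s, frobInner (B r * B s - B s * B r) (B r * B s - B s * B r) := by
    have h1 : ∀ r, ∑ s, frobInner (A r * A s - A s * A r) (A r * A s - A s * A r)
        = ∑ s, frobInner (A r * B s - B s * A r) (A r * B s - B s * A r) := fun r =>
      sum_frobInner_orthogonal U hU
        (LinearMap.mulLeft ℝ (A r) - LinearMap.mulRight ℝ (A r)) B
    have h2 : ∀ s, ∑ r, frobInner (A r * B s - B s * A r) (A r * B s - B s * A r)
        = ∑ r, frobInner (B r * B s - B s * B r) (B r * B s - B s * B r) := fun s =>
      sum_frobInner_orthogonal U hU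
        (LinearMap.mulRight ℝ (B s) - LinearMap.mulLeft ℝ (B s)) B
    simp only [h1]
    rw [Finset.sum_comm]
    simp only [h2]
    exact Finset.sum_comm
  rwa [hnorm, hcomm] at hmain

end Frobenius

lemma inner_shapeOp (e : OrthonormalBasis (Fin n) ℝ V) (β : V →ₗ[ℝ] V →ₗ[ℝ] W) (ξ : W)
    (x y : V) : ⟪shapeOp β ξ x, y⟫ = ⟪β x y, ξ⟫ := by
  have h : ∃ A : V →ₗ[ℝ] V, ∀ x y : V, ⟪β x y, ξ⟫ = ⟪A x, y⟫ := by
    refine ⟨∑ j, ((innerSL ℝ ξ).toLinearMap ∘ₗ β.flip (e j)).smulRight (e j), fun x y => ?_⟩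
    conv_lhs => rw [← e.sum_repr' y]
    simp [sum_inner, inner_smul_left, real_inner_comm, mul_comm]
  rw [shapeOp, dif_pos h]
  exact (h.choose_spec x y).symm

/-- The matrix of the bilinear form `⟪β(·,·), ξ⟫` in an orthonormal basis. -/
noncomputable def formMatrix (e : OrthonormalBasis (Fin n) ℝ V) (β : V →ₗ[ℝ] V →ₗ[ℝ] W) (ξ : W) :
    Matrix (Fin n) (Fin n) ℝ := Matrix.of fun i j => ⟪β (e i) (e j), ξ⟫

/-- The squared Hilbert–Schmidt norm of the trace-free part of `β`. -/
noncomputable def umbilicityDefect (e : OrthonormalBasis (Fin n) ℝ V)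
    (β : V →ₗ[ℝ] V →ₗ[ℝ] W) : ℝ :=
  ∑ i, ∑ j, ‖β (e i) (e j) - if i = j then meanCurv e β else 0‖ ^ 2

lemma umbilicityDefect_nonneg (e : OrthonormalBasis (Fin n) ℝ V) (β : V →ₗ[ℝ] V →ₗ[ℝ] W) :
    0 ≤ umbilicityDefect e β := by
  unfold umbilicityDefect; positivity

lemma sum_diag_eq_smul_meanCurv (hn : n ≠ 0) (e : OrthonormalBasis (Fin n) ℝ V)
    (β : V →ₗ[ℝ] V →ₗ[ℝ] W) : ∑ i, β (e i) (e i) = (n : ℝ) • meanCurv e β := by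
  rw [meanCurv, smul_smul, mul_inv_cancel₀ (Nat.cast_ne_zero.2 hn), one_smul]

lemma umbilicityDefect_eq (hn : n ≠ 0) (e : OrthonormalBasis (Fin n) ℝ V)
    (β : V →ₗ[ℝ] V →ₗ[ℝ] W) :
    umbilicityDefect e β = ∑ i, ∑ j, ‖β (e i) (e j)‖ ^ 2 - n * ‖meanCurv e β‖ ^ 2 := by
  have h : ∀ i j, ‖β (e i) (e j) - if i = j then meanCurv e β else 0‖ ^ 2
      = ‖β (e i) (e j)‖ ^ 2
        + if i = j then ‖meanCurv e β‖ ^ 2 - 2 * ⟪β (e i) (e j), meanCurv e β⟫ else 0 := by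
    intro i j
    split_ifs
    · rw [norm_sub_sq_real]; ring
    · simp
  simp only [umbilicityDefect, h, Finset.sum_add_distrib, Finset.sum_ite_eq, Finset.mem_univ,
    if_true, Finset.sum_sub_distrib, ← Finset.mul_sum, ← sum_inner,
    sum_diag_eq_smul_meanCurv hn, inner_smul_left, real_inner_self_eq_norm_sq]
  simp
  ring

lemma add_sq_sub_rho_eq (hn : 2 ≤ n) (c : ℝ) (e : OrthonormalBasis (Fin n) ℝ V)
    (β : V →ₗ[ℝ] V →ₗ[ℝ] W) :
    c + ‖meanCurv e β‖ ^ 2 - rho c e β = (n * (n - 1) : ℝ)⁻¹ * umbilicityDefect e β := by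
  have hn2 : (2 : ℝ) ≤ n := by exact_mod_cast hn
  have hn1 : (n : ℝ) - 1 ≠ 0 := by linarith
  have hn0 : (n : ℝ) ≠ 0 := by linarith
  have hr : ∑ i, ric c e β (e i) (e i) = c * (n - 1) * n + n * (n * ‖meanCurv e β‖ ^ 2)
      - ∑ i, ∑ j, ‖β (e i) (e j)‖ ^ 2 := by
    simp only [ric, Finset.sum_sub_distrib, Finset.sum_add_distrib, ← Finset.mul_sum, ← inner_sum,
      sum_diag_eq_smul_meanCurv (show n ≠ 0 by lia), inner_smul_right, real_inner_self_eq_norm_sq]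
    simp
  rw [rho, hr, umbilicityDefect_eq (by lia)]
  field_simp
  ring

lemma formMatrix_transpose (e : OrthonormalBasis (Fin n) ℝ V) (β : V →ₗ[ℝ] V →ₗ[ℝ] W)
    (hβ : IsSymmBil β) (ξ : W) : (formMatrix e β ξ).transpose = formMatrix e β ξ := by
  ext i j
  simp [formMatrix, hβ (e j) (e i)]

lemma sum_sq_inner (ξ : OrthonormalBasis (Fin m) ℝ W) (w : W) :
    ∑ a, ⟪w, ξ a⟫ ^ 2 = ‖w‖ ^ 2 := by
  rw [← ξ.sum_sq_norm_inner_left w]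
  simp

lemma inner_shapeOp_comp (e : OrthonormalBasis (Fin n) ℝ V) (β : V →ₗ[ℝ] V →ₗ[ℝ] W)
    (ξ η : W) (i j : Fin n) :
    ⟪shapeOp β ξ (shapeOp β η (e i)), e j⟫ = (formMatrix e β η * formMatrix e β ξ) i j := by
  have h : shapeOp β η (e i) = ∑ k, formMatrix e β η i k • e k := by
    conv_lhs => rw [← e.sum_repr' (shapeOp β η (e i))]
    refine Finset.sum_congr rfl fun k _ => ?_
    rw [real_inner_comm, inner_shapeOp e]
    rfl
  rw [h]
  simp only [map_sum, map_smul, sum_inner, inner_smul_left, inner_shapeOp e, Matrix.mul_apply]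
  rfl

lemma sum_norm_commutator_sq (e : OrthonormalBasis (Fin n) ℝ V) (β : V →ₗ[ℝ] V →ₗ[ℝ] W)
    (ξ η : W) :
    ∑ i, ‖(shapeOp β ξ ∘ₗ shapeOp β η - shapeOp β η ∘ₗ shapeOp β ξ) (e i)‖ ^ 2
      = frobInner (formMatrix e β ξ * formMatrix e β η - formMatrix e β η * formMatrix e β ξ)
          (formMatrix e β ξ * formMatrix e β η - formMatrix e β η * formMatrix e β ξ) := by
  rw [frobInner_self]
  refine Finset.sum_congr rfl fun i _ => ?_
  rw [← sum_sq_inner e]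
  refine Finset.sum_congr rfl fun j _ => ?_
  rw [LinearMap.sub_apply, inner_sub_left, LinearMap.comp_apply, LinearMap.comp_apply,
    inner_shapeOp_comp, inner_shapeOp_comp, Matrix.sub_apply, sub_sq_comm]

lemma rhoPerp_le (hn : 2 ≤ n) (e : OrthonormalBasis (Fin n) ℝ V)
    (ξ : OrthonormalBasis (Fin m) ℝ W) (β : V →ₗ[ℝ] V →ₗ[ℝ] W) (hβ : IsSymmBil β) :
    rhoPerp e ξ β ≤ (n * (n - 1) : ℝ)⁻¹ * umbilicityDefect e β := by
  have hn2 : (2 : ℝ) ≤ n := by exact_mod_cast hn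
  let B : Fin m → Matrix (Fin n) (Fin n) ℝ := fun a =>
    formMatrix e β (ξ a) - ⟪meanCurv e β, ξ a⟫ • 1
  have hB : ∀ a, (B a).transpose = B a := fun a => by
    simp [B, formMatrix_transpose e β hβ]
  have hcomm : ∀ a b, formMatrix e β (ξ a) * formMatrix e β (ξ b)
      - formMatrix e β (ξ b) * formMatrix e β (ξ a) = B a * B b - B b * B a := by
    intro a b
    simp only [B, sub_mul, mul_sub, Matrix.smul_mul, Matrix.mul_smul, Matrix.one_mul,
      Matrix.mul_one, smul_smul, mul_comm ⟪meanCurv e β, ξ a⟫]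
    abel
  have hnorm : ∑ a, frobInner (B a) (B a) = umbilicityDefect e β := by
    simp only [frobInner_self, umbilicityDefect]
    rw [Finset.sum_comm]
    refine Finset.sum_congr rfl fun i _ => ?_
    rw [Finset.sum_comm]
    refine Finset.sum_congr rfl fun j _ => ?_
    rw [← sum_sq_inner ξ]
    refine Finset.sum_congr rfl fun a _ => ?_
    by_cases h : i = j <;> simp [B, formMatrix, h, inner_sub_left]
  have hd := ddvv B hB
  rw [hnorm] at hd
  rw [rhoPerp]
  refine mul_le_mul_of_nonneg_left ?_ (inv_nonneg.2 (by nlinarith))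
  simp only [sum_norm_commutator_sq, hcomm]
  exact (Real.sqrt_le_sqrt hd).trans_eq (Real.sqrt_sq (umbilicityDefect_nonneg e β))

lemma norm_apply_self_sub_meanCurv_le (e : OrthonormalBasis (Fin n) ℝ V)
    (β : V →ₗ[ℝ] V →ₗ[ℝ] W) (x : V) (hx : ‖x‖ = 1) :
    ‖β x x - meanCurv e β‖ ≤ Real.sqrt (umbilicityDefect e β) := by
  let y : Fin n → ℝ := fun i => ⟪x, e i⟫
  have hy : ∑ i, y i ^ 2 = 1 := by rw [sum_sq_inner, hx]; norm_num
  have hxy : x = ∑ i, y i • e i := by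
    conv_lhs => rw [← e.sum_repr' x]
    simp only [y, real_inner_comm]
  have h1 : β x x - meanCurv e β = ∑ i, ∑ j, (y i * y j) •
      (β (e i) (e j) - if i = j then meanCurv e β else 0) := by
    have h2 : ∑ i, ∑ j, (y i * y j) • (if i = j then meanCurv e β else 0) = meanCurv e β := by
      simp only [smul_ite, smul_zero, Finset.sum_ite_eq, Finset.mem_univ, if_true]
      rw [← Finset.sum_smul]
      simp only [← sq, hy, one_smul]
    have h3 : β x x = ∑ i, ∑ j, (y i * y j) • β (e i) (e j) := by
      conv_lhs => rw [hxy]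
      simp only [map_sum, map_smul, LinearMap.sum_apply, LinearMap.smul_apply, Finset.smul_sum,
        smul_smul]
      exact Finset.sum_comm.trans (Finset.sum_congr rfl fun i _ => Finset.sum_congr rfl fun j _ => by
        rw [mul_comm])
    simp only [smul_sub, Finset.sum_sub_distrib, h2, ← h3]
  have hcs := Finset.sum_mul_sq_le_sq_mul_sq (Finset.univ : Finset (Fin n × Fin n))
    (fun p => |y p.1 * y p.2|)
    (fun p => ‖β (e p.1) (e p.2) - if p.1 = p.2 then meanCurv e β else 0‖)
  have hyy : ∑ p : Fin n × Fin n, |y p.1 * y p.2| ^ 2 = 1 := by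
    simp only [sq_abs, mul_pow, Fintype.sum_prod_type]
    rw [← Finset.sum_mul_sum, hy, one_mul]
  rw [hyy, one_mul, Fintype.sum_prod_type
    (f := fun p : Fin n × Fin n => ‖β (e p.1) (e p.2) - if p.1 = p.2 then meanCurv e β else 0‖ ^ 2)]
    at hcs
  refine Real.le_sqrt_of_sq_le (le_trans (pow_le_pow_left₀ (norm_nonneg _) ?_ 2) hcs)
  rw [h1, ← Fintype.sum_prod_type (f := fun p : Fin n × Fin n => (y p.1 * y p.2) •
      (β (e p.1) (e p.2) - if p.1 = p.2 then meanCurv e β else 0))]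
  refine (norm_sum_le _ _).trans_eq (Finset.sum_congr rfl fun p _ => ?_)
  rw [norm_smul, Real.norm_eq_abs]

lemma det_shapeOp (e : OrthonormalBasis (Fin n) ℝ V) (β : V →ₗ[ℝ] V →ₗ[ℝ] W) (ξ : W) :
    LinearMap.det (shapeOp β ξ) = (formMatrix e β ξ).det := by
  rw [← LinearMap.det_toMatrix e.toBasis, ← Matrix.det_transpose]
  congr 1
  ext i j
  rw [Matrix.transpose_apply, LinearMap.toMatrix_apply]
  simp [formMatrix, ← inner_shapeOp e, OrthonormalBasis.repr_apply_apply, real_inner_comm]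

lemma abs_det_shapeOp_le (e : OrthonormalBasis (Fin n) ℝ V) (β : V →ₗ[ℝ] V →ₗ[ℝ] W) (u : W)
    (hu : ‖u‖ = 1) (h0 : 0 < negIndex n (shapeOp β u)) (h1 : negIndex n (shapeOp β u) < n) :
    |LinearMap.det (shapeOp β u)| ≤ (2 * Real.sqrt (umbilicityDefect e β)) ^ n := by
  set R := Real.sqrt (umbilicityDefect e β)
  by_cases h : ∃ μ : Fin n → ℝ, Monotone μ ∧
      ∃ b : OrthonormalBasis (Fin n) ℝ V, ∀ i, shapeOp β u (b i) = μ i • b i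
  swap
  · simp [negIndex, sortedEigs, dif_neg h] at h0
  obtain ⟨-, b, hb⟩ := h.choose_spec
  have hs : sortedEigs n (shapeOp β u) = h.choose := by rw [sortedEigs, dif_pos h]
  rw [negIndex, hs] at h0 h1
  set μ := h.choose
  have hμ : ∀ i, |μ i - ⟪meanCurv e β, u⟫| ≤ R := by
    intro i
    have : μ i = ⟪β (b i) (b i), u⟫ := by
      rw [← inner_shapeOp e, hb, inner_smul_left, real_inner_self_eq_norm_sq]
      simp
    rw [this, ← inner_sub_left]
    refine (abs_real_inner_le_norm _ _).trans ?_
    rw [hu, mul_one]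
    exact norm_apply_self_sub_meanCurv_le e β (b i) (b.norm_eq_one i)
  obtain ⟨i, hi⟩ := Finset.card_pos.1 h0
  have hi' : μ i < 0 := (Finset.mem_filter.1 hi).2
  obtain ⟨j, hj⟩ : ∃ j, 0 ≤ μ j := by
    by_contra! hall
    rw [Finset.filter_true_of_mem (fun k _ => hall k)] at h1
    simp at h1
  have bound : ∀ k, |μ k| ≤ 2 * R := by
    intro k
    have hk := abs_le.1 (hμ k)
    have hi2 := abs_le.1 (hμ i)
    have hj2 := abs_le.1 (hμ j)
    rw [abs_le]
    constructor <;> linarith [hk.1, hk.2, hi2.1, hj2.2]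
  have hdet : LinearMap.det (shapeOp β u) = ∏ k, μ k := by
    rw [← LinearMap.det_toMatrix b.toBasis, ← Matrix.det_diagonal]
    congr 1
    ext k l
    rw [LinearMap.toMatrix_apply]
    by_cases hkl : k = l
    · subst hkl; simp [hb]
    · simp [hb, hkl]
  rw [hdet, Finset.abs_prod]
  calc ∏ k, |μ k| ≤ ∏ _k : Fin n, (2 * R) :=
        Finset.prod_le_prod (fun k _ => abs_nonneg _) fun k _ => bound k
    _ = (2 * R) ^ n := by simp

lemma psi_zero_nonneg (n m : ℕ)
    (β : EuclideanSpace ℝ (Fin n) →ₗ[ℝ] EuclideanSpace ℝ (Fin n) →ₗ[ℝ]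
      EuclideanSpace ℝ (Fin m)) : 0 ≤ psi n m 0 β :=
  integral_nonneg fun _ => abs_nonneg _

lemma psi_zero_le (n m : ℕ) (β : EuclideanSpace ℝ (Fin n) →ₗ[ℝ] EuclideanSpace ℝ (Fin n) →ₗ[ℝ]
      EuclideanSpace ℝ (Fin m)) :
    psi n m 0 β ≤
      (2 * Real.sqrt (umbilicityDefect (EuclideanSpace.basisFun (Fin n) ℝ) β)) ^ n *
        (volume : Measure (EuclideanSpace ℝ (Fin m))).toSphere.real Set.univ := by
  set e := EuclideanSpace.basisFun (Fin n) ℝ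
  set C := (2 * Real.sqrt (umbilicityDefect e β)) ^ n
  have hC : 0 ≤ C := by positivity
  have hcont : Continuous fun u : Metric.sphere (0 : EuclideanSpace ℝ (Fin m)) 1 =>
      |LinearMap.det (shapeOp β (u : EuclideanSpace ℝ (Fin m)))| := by
    simp only [det_shapeOp e]
    refine (Continuous.matrix_det ?_).abs
    refine continuous_matrix fun i j => ?_
    simp only [formMatrix, Matrix.of_apply]
    fun_prop
  rw [psi]
  set S := {u : Metric.sphere (0 : EuclideanSpace ℝ (Fin m)) 1 |
      0 < negIndex n (shapeOp β (u : EuclideanSpace ℝ (Fin m))) ∧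
      negIndex n (shapeOp β (u : EuclideanSpace ℝ (Fin m))) < n - 0}
  set ν := (volume : Measure (EuclideanSpace ℝ (Fin m))).toSphere
  have hae : ∀ᵐ u : Metric.sphere (0 : EuclideanSpace ℝ (Fin m)) 1 ∂(ν.restrict S),
      ‖|LinearMap.det (shapeOp β (u : EuclideanSpace ℝ (Fin m)))|‖ ≤ C := by
    rw [ae_restrict_iff (measurableSet_le hcont.norm.measurable measurable_const)]
    refine Filter.Eventually.of_forall fun u hu => ?_
    rw [Real.norm_eq_abs, abs_abs]
    exact abs_det_shapeOp_le e β u (by simp) hu.1 hu.2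
  refine (le_abs_self _).trans ((norm_integral_le_of_norm_le_const hae).trans ?_)
  refine mul_le_mul_of_nonneg_left ?_ hC
  rw [measureReal_restrict_apply_univ]
  exact measureReal_mono (Set.subset_univ _)

theorem stmt13 (n m : ℕ) (hn : 2 ≤ n) (hm : 1 ≤ m) (c : ℝ)
    (lam : ℝ) (hlam0 : 0 ≤ lam) (hlam1 : lam < 1) :
    ∃ δ : ℝ, 0 < δ ∧ ∀ β : EuclideanSpace ℝ (Fin n) →ₗ[ℝ] EuclideanSpace ℝ (Fin n) →ₗ[ℝ] EuclideanSpace ℝ (Fin m), IsSymmBil β →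
      c + ‖meanCurv (EuclideanSpace.basisFun (Fin n) ℝ) β‖ ^ 2
          - lam * rhoPerp (EuclideanSpace.basisFun (Fin n) ℝ)
              (EuclideanSpace.basisFun (Fin m) ℝ) β
          - rho c (EuclideanSpace.basisFun (Fin n) ℝ) β
        ≥ δ * psi n m 0 β ^ ((2 : ℝ) / (n : ℝ)) := by
  set e := EuclideanSpace.basisFun (Fin n) ℝ
  set v := (volume : Measure (EuclideanSpace ℝ (Fin m))).toSphere.real Set.univ
  have hn2 : (2 : ℝ) ≤ n := by exact_mod_cast hn
  have hv : 0 ≤ v := measureReal_nonneg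
  have hk : 0 < (n * (n - 1) : ℝ)⁻¹ := inv_pos.2 (by nlinarith)
  set k := (n * (n - 1) : ℝ)⁻¹
  have hK : 0 ≤ v ^ ((2 : ℝ) / n) := Real.rpow_nonneg hv _
  set K := v ^ ((2 : ℝ) / n) with hKdef
  have hδ : 0 < (1 - lam) * k / (4 * K + 1) :=
    div_pos (mul_pos (by linarith) hk) (by linarith)
  refine ⟨(1 - lam) * k / (4 * K + 1), hδ, fun β hβ => ?_⟩
  have hN := umbilicityDefect_nonneg e β
  have h1 := add_sq_sub_rho_eq hn c e β
  have h2 := mul_le_mul_of_nonneg_left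
    (rhoPerp_le hn e (EuclideanSpace.basisFun (Fin m) ℝ) β hβ) hlam0
  have hψ : psi n m 0 β ^ ((2 : ℝ) / (n : ℝ)) ≤ 4 * umbilicityDefect e β * K := by
    refine (Real.rpow_le_rpow (psi_zero_nonneg n m β) (psi_zero_le n m β)
      (by positivity)).trans_eq ?_
    rw [Real.mul_rpow (by positivity) hv, ← Real.rpow_natCast, ← Real.rpow_mul (by positivity),
      mul_div_cancel₀ (2 : ℝ) (by linarith : (n : ℝ) ≠ 0), Real.rpow_two, mul_pow,
      Real.sq_sqrt hN]
    norm_num [hKdef]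
  have h3 : (1 - lam) * k / (4 * K + 1) * psi n m 0 β ^ ((2 : ℝ) / (n : ℝ))
      ≤ (1 - lam) * k * umbilicityDefect e β := by
    refine (mul_le_mul_of_nonneg_left hψ hδ.le).trans ?_
    rw [div_mul_eq_mul_div, div_le_iff₀ (by linarith)]
    have : 0 ≤ (1 - lam) * k * umbilicityDefect e β :=
      mul_nonneg (mul_nonneg (by linarith) hk.le) hN
    nlinarith
  linarith

end Paper
end

section
/- For the bilinear map β_{μ,σ} defined in the context and every c ∈ ℝ, one has c + H_{β_{μ,σ}}² − ρ⊥(β_{μ,σ}) − ρ_c(β_{μ,σ}) = (4(3n−8)/(n²(n−1)))·σ². -/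
open scoped RealInnerProductSpace BigOperators
open MeasureTheory Classical

namespace Paper

variable {V W : Type*} [NormedAddCommGroup V] [InnerProductSpace ℝ V]
  [NormedAddCommGroup W] [InnerProductSpace ℝ W]

variable {n m : ℕ}

/-- The endomorphism `A₁` of `ℝⁿ` from the counterexample. -/
noncomputable def A1 (n : ℕ) (μ σ : ℝ) :
    EuclideanSpace ℝ (Fin n) →ₗ[ℝ] EuclideanSpace ℝ (Fin n) :=
  Matrix.toEuclideanLin (Matrix.diagonal fun i : Fin n =>
    if (i : ℕ) = 0 then μ else if (i : ℕ) = 1 then -μ else if (i : ℕ) = 2 then -σ else σ)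

/-- The endomorphism `A₂` of `ℝⁿ` from the counterexample. -/
noncomputable def A2 (n : ℕ) (μ σ : ℝ) :
    EuclideanSpace ℝ (Fin n) →ₗ[ℝ] EuclideanSpace ℝ (Fin n) :=
  Matrix.toEuclideanLin (Matrix.of fun i j : Fin n =>
    if ((i : ℕ) = 0 ∧ (j : ℕ) = 1) ∨ ((i : ℕ) = 1 ∧ (j : ℕ) = 0) then μ
    else if i = j ∧ (i : ℕ) = 2 then -σ
    else if i = j ∧ 3 ≤ (i : ℕ) then σ else 0)

/-- The symmetric bilinear map `β_{μ,σ}(x,y) = ⟨A₁x,y⟩ξ₁ + ⟨A₂x,y⟩ξ₂`. -/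
noncomputable def betaMS (n m : ℕ) (hm : 2 ≤ m) (μ σ : ℝ) : EuclideanSpace ℝ (Fin n) →ₗ[ℝ] EuclideanSpace ℝ (Fin n) →ₗ[ℝ] EuclideanSpace ℝ (Fin m) :=
  LinearMap.mk₂ ℝ
    (fun x y => ⟪A1 n μ σ x, y⟫ • (EuclideanSpace.basisFun (Fin m) ℝ ⟨0, by omega⟩)
      + ⟪A2 n μ σ x, y⟫ • (EuclideanSpace.basisFun (Fin m) ℝ ⟨1, by omega⟩))
    (by intro x x' y; simp only [map_add, inner_add_left, add_smul]; abel)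
    (by intro a x y; simp only [_root_.map_smul, real_inner_smul_left, smul_add, smul_smul])
    (by intro x y y'; simp only [inner_add_right, add_smul]; abel)
    (by intro a x y; simp only [real_inner_smul_right, smul_add, smul_smul])

section General

variable {V W : Type*} [NormedAddCommGroup V] [InnerProductSpace ℝ V]
  [NormedAddCommGroup W] [InnerProductSpace ℝ W]

theorem shapeOp_eq_of_forall_inner {β : V →ₗ[ℝ] V →ₗ[ℝ] W} {ξ : W} {A : V →ₗ[ℝ] V}
    (hA : ∀ x y : V, ⟪β x y, ξ⟫ = ⟪A x, y⟫) : shapeOp β ξ = A := by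
  have h : ∃ A : V →ₗ[ℝ] V, ∀ x y : V, ⟪β x y, ξ⟫ = ⟪A x, y⟫ := ⟨A, hA⟩
  rw [shapeOp, dif_pos h]
  ext x
  exact ext_inner_right ℝ fun y => by rw [← h.choose_spec x y, hA]

/-- The trace of the Ricci tensor in terms of the mean curvature and the norm of `β`. -/
theorem sum_ric_basis {n : ℕ} (hn : n ≠ 0) (c : ℝ) (e : OrthonormalBasis (Fin n) ℝ V)
    (β : V →ₗ[ℝ] V →ₗ[ℝ] W) :
    ∑ i, ric c e β (e i) (e i) =
      c * n * (n - 1) + n ^ 2 * ‖meanCurv e β‖ ^ 2 - ∑ i, ∑ j, ‖β (e i) (e j)‖ ^ 2 := by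
  have hn' : (n : ℝ) ≠ 0 := by exact_mod_cast hn
  have hH : ∑ i, β (e i) (e i) = (n : ℝ) • meanCurv e β := by
    rw [meanCurv, smul_smul, mul_inv_cancel₀ hn', one_smul]
  simp only [ric, Finset.sum_sub_distrib, Finset.sum_add_distrib, ← Finset.mul_sum, ← inner_sum,
    hH, real_inner_self_eq_norm_sq, e.norm_eq_one, real_inner_smul_right]
  simp
  ring

end General

/-- The coefficients of `A₁` in the standard basis. -/
noncomputable def coeffA1 (n : ℕ) (μ σ : ℝ) (i : Fin n) : ℝ :=
  if (i : ℕ) = 0 then μ else if (i : ℕ) = 1 then -μ else if (i : ℕ) = 2 then -σ else σ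

/-- The coefficients of `A₂`, which maps `e i` to a multiple of `e (swap 0 1 i)`. -/
noncomputable def coeffA2 (n : ℕ) (μ σ : ℝ) (i : Fin n) : ℝ :=
  if (i : ℕ) < 2 then μ else if (i : ℕ) = 2 then -σ else σ

theorem A1_basisFun (n : ℕ) (μ σ : ℝ) (i : Fin n) :
    A1 n μ σ (EuclideanSpace.basisFun (Fin n) ℝ i) =
      coeffA1 n μ σ i • EuclideanSpace.basisFun (Fin n) ℝ i := by
  ext j
  simp [A1, Matrix.toLpLin_apply]
  grind [coeffA1]

theorem A2_basisFun (k : ℕ) (μ σ : ℝ) (i : Fin (k + 3)) :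
    A2 (k + 3) μ σ (EuclideanSpace.basisFun (Fin (k + 3)) ℝ i) =
      coeffA2 (k + 3) μ σ i • EuclideanSpace.basisFun (Fin (k + 3)) ℝ (Equiv.swap 0 1 i) := by
  ext j
  simp [A2, Matrix.toLpLin_apply, Equiv.swap_apply_def]
  simp only [coeffA2]
  have h0 : ((0 : Fin (k + 3)) : ℕ) = 0 := rfl
  have h1 : ((1 : Fin (k + 3)) : ℕ) = 1 := by simp
  grind

theorem inner_A2_basisFun_self (k : ℕ) (μ σ : ℝ) (i : Fin (k + 3)) :
    ⟪A2 (k + 3) μ σ (EuclideanSpace.basisFun (Fin (k + 3)) ℝ i),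
      EuclideanSpace.basisFun (Fin (k + 3)) ℝ i⟫ =
      if (i : ℕ) < 2 then 0 else if (i : ℕ) = 2 then -σ else σ := by
  rw [A2_basisFun, real_inner_smul_left, OrthonormalBasis.inner_eq_ite, Equiv.swap_apply_def,
    coeffA2]
  have h0 : ((0 : Fin (k + 3)) : ℕ) = 0 := rfl
  have h1 : ((1 : Fin (k + 3)) : ℕ) = 1 := by simp
  grind

theorem coeffA1_sub_coeffA1_swap_sq (k : ℕ) (μ σ : ℝ) (i : Fin (k + 3)) :
    (coeffA1 (k + 3) μ σ (Equiv.swap 0 1 i) - coeffA1 (k + 3) μ σ i) ^ 2 =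
      if (i : ℕ) < 2 then 4 * μ ^ 2 else 0 := by
  rw [Equiv.swap_apply_def, coeffA1, coeffA1]
  have h0 : ((0 : Fin (k + 3)) : ℕ) = 0 := rfl
  have h1 : ((1 : Fin (k + 3)) : ℕ) = 1 := by simp
  grind

section Beta

variable {n m : ℕ} (hm : 2 ≤ m) (μ σ : ℝ)

theorem betaMS_apply (x y : EuclideanSpace ℝ (Fin n)) :
    betaMS n m hm μ σ x y =
      ⟪A1 n μ σ x, y⟫ • EuclideanSpace.basisFun (Fin m) ℝ ⟨0, by omega⟩
      + ⟪A2 n μ σ x, y⟫ • EuclideanSpace.basisFun (Fin m) ℝ ⟨1, by omega⟩ := rfl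

theorem shapeOp_betaMS (a : Fin m) :
    shapeOp (betaMS n m hm μ σ) (EuclideanSpace.basisFun (Fin m) ℝ a) =
      if (a : ℕ) = 0 then A1 n μ σ else if (a : ℕ) = 1 then A2 n μ σ else 0 := by
  apply shapeOp_eq_of_forall_inner
  intro x y
  rw [betaMS_apply, inner_add_left, real_inner_smul_left, real_inner_smul_left,
    OrthonormalBasis.inner_eq_ite, OrthonormalBasis.inner_eq_ite]
  simp only [Fin.ext_iff]
  split_ifs <;> first | omega | simp

theorem norm_smul_add_smul_basisFun_sq (s t : ℝ) :
    ‖s • EuclideanSpace.basisFun (Fin m) ℝ ⟨0, by omega⟩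
      + t • EuclideanSpace.basisFun (Fin m) ℝ ⟨1, by omega⟩‖ ^ 2 = s ^ 2 + t ^ 2 := by
  rw [norm_add_sq_real, real_inner_smul_left, real_inner_smul_right,
    OrthonormalBasis.inner_eq_ite, norm_smul, norm_smul]
  simp

theorem sum_norm_betaMS_sq (x : EuclideanSpace ℝ (Fin n)) :
    ∑ j, ‖betaMS n m hm μ σ x (EuclideanSpace.basisFun (Fin n) ℝ j)‖ ^ 2 =
      ‖A1 n μ σ x‖ ^ 2 + ‖A2 n μ σ x‖ ^ 2 := by
  simp only [betaMS_apply, norm_smul_add_smul_basisFun_sq hm, Finset.sum_add_distrib]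
  rw [← OrthonormalBasis.sum_sq_inner_left (EuclideanSpace.basisFun (Fin n) ℝ) (A1 n μ σ x),
    ← OrthonormalBasis.sum_sq_inner_left (EuclideanSpace.basisFun (Fin n) ℝ) (A2 n μ σ x)]

end Beta

section Values

variable {m : ℕ} (hm : 2 ≤ m) (k : ℕ) (μ σ : ℝ)

theorem sum_sum_norm_betaMS_sq :
    ∑ i, ∑ j, ‖betaMS (k + 3) m hm μ σ (EuclideanSpace.basisFun (Fin (k + 3)) ℝ i)
      (EuclideanSpace.basisFun (Fin (k + 3)) ℝ j)‖ ^ 2 = 4 * μ ^ 2 + 2 * (k + 1) * σ ^ 2 := by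
  simp only [sum_norm_betaMS_sq, A1_basisFun, A2_basisFun, norm_smul,
    OrthonormalBasis.norm_eq_one, mul_one, Real.norm_eq_abs, sq_abs]
  simp [Fin.sum_univ_succ, coeffA1, coeffA2]
  ring

theorem norm_meanCurv_betaMS_sq :
    ‖meanCurv (EuclideanSpace.basisFun (Fin (k + 3)) ℝ) (betaMS (k + 3) m hm μ σ)‖ ^ 2 =
      2 * (k - 1) ^ 2 * σ ^ 2 / (k + 3) ^ 2 := by
  have h : (k : ℝ) + 3 ≠ 0 := by positivity
  simp only [meanCurv, betaMS_apply, Finset.sum_add_distrib, ← Finset.sum_smul, norm_smul,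
    mul_pow, norm_smul_add_smul_basisFun_sq hm, inner_A2_basisFun_self, A1_basisFun,
    real_inner_smul_left, OrthonormalBasis.inner_eq_one, mul_one]
  simp [Fin.sum_univ_succ, coeffA1]
  field_simp
  ring

theorem sum_norm_commutator_sq_s15 :
    ∑ i, ‖(A1 (k + 3) μ σ ∘ₗ A2 (k + 3) μ σ - A2 (k + 3) μ σ ∘ₗ A1 (k + 3) μ σ)
      (EuclideanSpace.basisFun (Fin (k + 3)) ℝ i)‖ ^ 2 = 8 * μ ^ 4 := by
  simp only [LinearMap.sub_apply, LinearMap.comp_apply, A1_basisFun, A2_basisFun,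
    _root_.map_smul, smul_smul, ← sub_smul, norm_smul, OrthonormalBasis.norm_eq_one, mul_one,
    Real.norm_eq_abs, sq_abs, mul_comm (coeffA1 (k + 3) μ σ _), ← mul_sub, mul_pow,
    coeffA1_sub_coeffA1_swap_sq]
  simp [Fin.sum_univ_succ, coeffA2]
  ring

theorem rhoPerp_betaMS :
    rhoPerp (EuclideanSpace.basisFun (Fin (k + 3)) ℝ) (EuclideanSpace.basisFun (Fin m) ℝ)
      (betaMS (k + 3) m hm μ σ) = 4 * μ ^ 2 / ((k + 3) * (k + 2)) := by
  obtain ⟨l, rfl⟩ := Nat.exists_eq_add_of_le' hm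
  have hcomm := sum_norm_commutator_sq_s15 k μ σ
  have hcomm' : ∑ i, ‖(A2 (k + 3) μ σ ∘ₗ A1 (k + 3) μ σ - A1 (k + 3) μ σ ∘ₗ A2 (k + 3) μ σ)
      (EuclideanSpace.basisFun (Fin (k + 3)) ℝ i)‖ ^ 2 = 8 * μ ^ 4 := by
    rw [← hcomm]
    refine Finset.sum_congr rfl fun i _ => ?_
    rw [← neg_sub, LinearMap.neg_apply, norm_neg]
  have hsqrt : √(8 * μ ^ 4 + 8 * μ ^ 4) = 4 * μ ^ 2 := by
    rw [show 8 * μ ^ 4 + 8 * μ ^ 4 = (4 * μ ^ 2) ^ 2 by ring, Real.sqrt_sq (by positivity)]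
  rw [rhoPerp]
  simp only [shapeOp_betaMS, Fin.sum_univ_succ (n := l + 1), Fin.sum_univ_succ (n := l)]
  simp only [Fin.val_zero, Fin.val_succ, if_true, Nat.add_eq_zero_iff, one_ne_zero, and_false,
    if_false, zero_add, Nat.add_eq_right, LinearMap.comp_zero, LinearMap.zero_comp, sub_self,
    LinearMap.zero_apply, norm_zero, ne_eq, OfNat.ofNat_ne_zero, not_false_eq_true, zero_pow,
    Finset.sum_const_zero, add_zero, hcomm, hcomm', hsqrt]
  push_cast
  rw [show (k : ℝ) + 3 - 1 = k + 2 by ring]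
  field_simp

end Values

theorem stmt15 (n m : ℕ) (hn : 3 ≤ n) (hm : 2 ≤ m)
    (μ σ : ℝ) (hμ : 0 < μ) (hσ : 0 < σ) (c : ℝ) :
    c + ‖meanCurv (EuclideanSpace.basisFun (Fin n) ℝ) (betaMS n m hm μ σ)‖ ^ 2
        - rhoPerp (EuclideanSpace.basisFun (Fin n) ℝ) (EuclideanSpace.basisFun (Fin m) ℝ)
            (betaMS n m hm μ σ)
        - rho c (EuclideanSpace.basisFun (Fin n) ℝ) (betaMS n m hm μ σ)
      = (4 * (3 * (n : ℝ) - 8) / ((n : ℝ) ^ 2 * ((n : ℝ) - 1))) * σ ^ 2 := by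
  obtain ⟨k, rfl⟩ := Nat.exists_eq_add_of_le' hn
  rw [rho, sum_ric_basis (by omega), sum_sum_norm_betaMS_sq, norm_meanCurv_betaMS_sq,
    rhoPerp_betaMS]
  push_cast
  rw [show (k : ℝ) + 3 - 1 = k + 2 by ring]
  field_simp
  ring

end Paper
end
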